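/- arXiv:2103.07400 — 2 statements merged into one kernel-verified Lean document; each statement's English description precedes it below -/
import Mathlib

section
/- Let n,m ≥ 1, L,β,γ > 0, and ε,ε′ ∈ ℝ with |ε−ε′| > |γ−β|/2; set q = e^{−2πβ/L}, t = e^{−2πγ/L}, ξ = e^{−2πε/L}, ξ′ = e^{−2πε′/L}. For P,Q ∈ Λ_{n,m;q,t} define Ψ^{(P)}(u,v) := P(x,y) Ψ_0(u,v;β,γ) with x_i = e^{2πi u_i/L}, y_j = e^{2πi v_j/L}. Then ∫_{[−L/2,L/2]^n} ds ∫_{[−L/2,L/2]^m} dr Ψ^{(P)}(s+iε·(1,…,1), r+iε′·(1,…,1)) · conj(Ψ^{(Q)}(s−iε·(1,…,1), r−iε′·(1,…,1))) = n! m! L^{n+m} exp(nmπ(β−γ)/L) · ⟨P,Q⟩′_{n,m;q,t}(ξ,ξ′). -/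
open Complex MeasureTheory Finset

noncomputable section

/-- The infinite q-Pochhammer symbol `(a;q)_∞`. -/
def qPochInf (a q : ℂ) : ℂ := ∏' k : ℕ, (1 - a * q ^ k)

/-- The weight function `Δ_N(z;q,t)`. -/
def DeltaW {N : ℕ} (q t : ℂ) (z : Fin N → ℂ) : ℂ :=
  ∏ i : Fin N, ∏ j : Fin N,
    if i ≠ j then qPochInf (z i / z j) q / qPochInf (t * (z i / z j)) q else 1

/-- The weight function `Δ_{n,m}(x,y;q,t)` for real parameters `0 < q,t < 1`. -/
def DeltaNM (n m : ℕ) (q t : ℝ) (x : Fin n → ℂ) (y : Fin m → ℂ) : ℂ :=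
  DeltaW (q : ℂ) (t : ℂ) x * DeltaW (t : ℂ) (q : ℂ) y /
    ∏ i : Fin n, ∏ j : Fin m,
      ((1 - (Real.sqrt q : ℂ)⁻¹ * (Real.sqrt t : ℂ) * (x i / y j)) *
        (1 - (Real.sqrt q : ℂ)⁻¹ * (Real.sqrt t : ℂ) * (y j / x i)))

/-- Membership in the algebra `Λ_{n,m;q,t}`: `P` is (the evaluation of) a polynomial in
`x_1,…,x_n,y_1,…,y_m`, symmetric in each set of variables separately, and satisfying the
symmetry condition `T_{q,x_i} P = T_{t⁻¹,y_j} P` at `q^{1/2} x_i = t^{-1/2} y_j`. -/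
def InLambda (n m : ℕ) (q t : ℝ) (P : (Fin n → ℂ) → (Fin m → ℂ) → ℂ) : Prop :=
  (∃ p : MvPolynomial (Fin n ⊕ Fin m) ℂ,
      ∀ (x : Fin n → ℂ) (y : Fin m → ℂ), P x y = MvPolynomial.eval (Sum.elim x y) p) ∧
    (∀ (σ : Equiv.Perm (Fin n)) (τ : Equiv.Perm (Fin m)) (x : Fin n → ℂ) (y : Fin m → ℂ),
      P (x ∘ σ) (y ∘ τ) = P x y) ∧
    ∀ (i : Fin n) (j : Fin m) (x : Fin n → ℂ) (y : Fin m → ℂ),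
      (Real.sqrt q : ℂ) * x i = (Real.sqrt t : ℂ)⁻¹ * y j →
        P (Function.update x i ((q : ℂ) * x i)) y = P x (Function.update y j ((t : ℂ)⁻¹ * y j))

/-- The conjugate `Q*(x,y) = conj (Q(1/conj x, 1/conj y))`. -/
def starFun {n m : ℕ} (Q : (Fin n → ℂ) → (Fin m → ℂ) → ℂ) :
    (Fin n → ℂ) → (Fin m → ℂ) → ℂ := fun x y =>
  starRingEnd ℂ (Q (fun i => (starRingEnd ℂ (x i))⁻¹) (fun j => (starRingEnd ℂ (y j))⁻¹))

/-- The sesquilinear pairing `⟨P,Q⟩′_{n,m;q,t}(ξ,ξ′)`, as an iterated torus integral. -/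
def pairingNM (n m : ℕ) (q t : ℝ) (P Q : (Fin n → ℂ) → (Fin m → ℂ) → ℂ) (ξ ξ' : ℝ) : ℂ :=
  (1 / ((n.factorial : ℂ) * (m.factorial : ℂ))) * (1 / (2 * (Real.pi : ℂ)) ^ (n + m)) *
    ∫ θ in Set.univ.pi fun _ : Fin n => Set.Ioc (0 : ℝ) (2 * Real.pi),
      ∫ φ in Set.univ.pi fun _ : Fin m => Set.Ioc (0 : ℝ) (2 * Real.pi),
        DeltaNM n m q t (fun i => (ξ : ℂ) * Complex.exp (Complex.I * (θ i : ℂ)))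
            (fun j => (ξ' : ℂ) * Complex.exp (Complex.I * (φ j : ℂ))) *
          P (fun i => (ξ : ℂ) * Complex.exp (Complex.I * (θ i : ℂ)))
            (fun j => (ξ' : ℂ) * Complex.exp (Complex.I * (φ j : ℂ))) *
          starFun Q (fun i => (ξ : ℂ) * Complex.exp (Complex.I * (θ i : ℂ)))
            (fun j => (ξ' : ℂ) * Complex.exp (Complex.I * (φ j : ℂ)))

/-- The trigonometric Gamma function `G(r,a;z)`. -/
def trigGamma (r a : ℝ) (z : ℂ) : ℂ :=
  ∏' k : ℕ,
    (1 - Complex.exp (2 * Complex.I * (r : ℂ) * (z + Complex.I * (a : ℂ) * (k : ℂ) + Complex.I * (a : ℂ) / 2)))⁻¹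

/-- The weight function `w(r,a,b;z)`. -/
def wFun (r a b : ℝ) (z : ℂ) : ℂ :=
  trigGamma r a (z + Complex.I * (b : ℂ) - Complex.I * (a : ℂ) / 2) *
      trigGamma r a (-z + Complex.I * (b : ℂ) - Complex.I * (a : ℂ) / 2) /
    (trigGamma r a (z - Complex.I * (a : ℂ) / 2) * trigGamma r a (-z - Complex.I * (a : ℂ) / 2))

/-- The (formal) groundstate wave function `Ψ₀(u,v;β,γ)`; the square roots of the products of
`w`-factors (which are nonnegative real for real arguments) are taken as nonnegative real
square roots. -/
def Psi0 (n m : ℕ) (L β γ : ℝ) (u : Fin n → ℂ) (v : Fin m → ℂ) : ℂ :=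
  ((Real.sqrt (∏ i : Fin n, ∏ j : Fin n,
      if i < j then (wFun (Real.pi / L) β γ (u i - u j)).re else 1) : ℝ) : ℂ) *
    ((Real.sqrt (∏ i : Fin m, ∏ j : Fin m,
      if i < j then (wFun (Real.pi / L) γ β (v i - v j)).re else 1) : ℝ) : ℂ) /
    ∏ i : Fin n, ∏ j : Fin m,
      (2 * Complex.sin ((Real.pi : ℂ) * (u i - v j + Complex.I * (γ : ℂ) / 2 - Complex.I * (β : ℂ) / 2) / (L : ℂ)))


/-- The wave function `Ψ^{(P)}(u,v) = P(x,y)Ψ₀(u,v;β,γ)` with `x_i = e^{2πi u_i/L}`,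
`y_j = e^{2πi v_j/L}`. -/
def PsiWave (n m : ℕ) (L β γ : ℝ) (P : (Fin n → ℂ) → (Fin m → ℂ) → ℂ)
    (u : Fin n → ℂ) (v : Fin m → ℂ) : ℂ :=
  P (fun i => Complex.exp (2 * (Real.pi : ℂ) * Complex.I * u i / (L : ℂ)))
      (fun j => Complex.exp (2 * (Real.pi : ℂ) * Complex.I * v j / (L : ℂ))) *
    Psi0 n m L β γ u v

lemma norm_ofReal_lt_one {q : ℝ} (hq₀ : 0 < q) (hq₁ : q < 1) : ‖(q : ℂ)‖ < 1 := by
  rwa [Complex.norm_real, Real.norm_of_nonneg hq₀.le]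

lemma summable_norm_qPochInf (a : ℂ) {q : ℂ} (hq : ‖q‖ < 1) :
    Summable fun k : ℕ => ‖-(a * q ^ k)‖ := by
  simp only [norm_neg, norm_mul, norm_pow]
  exact (summable_geometric_of_lt_one (norm_nonneg _) hq).mul_left _

lemma multipliable_qPochInf (a : ℂ) {q : ℂ} (hq : ‖q‖ < 1) :
    Multipliable fun k : ℕ => 1 - a * q ^ k := by
  simpa only [sub_eq_add_neg] using multipliable_one_add_of_summable (summable_norm_qPochInf a hq)

lemma qPochInf_ne_zero {a q : ℂ} (hq : ‖q‖ < 1) (h : ∀ k : ℕ, 1 - a * q ^ k ≠ 0) :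
    qPochInf a q ≠ 0 := by
  simp only [qPochInf, sub_eq_add_neg] at h ⊢
  exact tprod_one_add_ne_zero_of_summable h (summable_norm_qPochInf a hq)

/-- The inverse of `(a;q)_∞` as an infinite product, including the degenerate case where a factor
vanishes. -/
lemma tprod_inv_qPochInf (a : ℂ) {q : ℂ} (hq : ‖q‖ < 1) :
    ∏' k : ℕ, (1 - a * q ^ k)⁻¹ = (qPochInf a q)⁻¹ := by
  by_cases h : ∃ k : ℕ, 1 - a * q ^ k = 0
  · rw [qPochInf, (hasProd_zero_of_exists_eq_zero h).tprod_eq, inv_zero]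
    exact (hasProd_zero_of_exists_eq_zero (h.imp fun k hk => by rw [hk, inv_zero])).tprod_eq
  · push Not at h
    exact (multipliable_qPochInf a hq).tprod_inv₀ (qPochInf_ne_zero hq h)

lemma conj_qPochInf (a : ℂ) (q : ℝ) (hq : ‖(q : ℂ)‖ < 1) :
    starRingEnd ℂ (qPochInf a q) = qPochInf (starRingEnd ℂ a) q := by
  rw [qPochInf, (multipliable_qPochInf a hq).map_tprod (starRingEnd ℂ) Complex.continuous_conj]
  simp [qPochInf]

lemma trigGamma_sub {r a : ℝ} (h : 0 < r * a) (z : ℂ) :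
    trigGamma r a (z - Complex.I * a / 2) =
      (qPochInf (Complex.exp (2 * Complex.I * r * z)) (Real.exp (-2 * r * a) : ℝ))⁻¹ := by
  rw [← tprod_inv_qPochInf _ (norm_ofReal_lt_one (Real.exp_pos _)
    (Real.exp_lt_one_iff.2 (by linarith))), trigGamma]
  refine tprod_congr fun k => ?_
  rw [Complex.ofReal_exp, ← Complex.exp_nat_mul, ← Complex.exp_add]
  congr 3
  push_cast
  linear_combination (2 * r * a * k : ℂ) * Complex.I_sq

lemma wFun_eq {r a : ℝ} (h : 0 < r * a) (b : ℝ) (z : ℂ) :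
    wFun r a b z =
      (qPochInf (Complex.exp (2 * Complex.I * r * z)) (Real.exp (-2 * r * a) : ℝ) /
        qPochInf ((Real.exp (-2 * r * b) : ℝ) * Complex.exp (2 * Complex.I * r * z))
          (Real.exp (-2 * r * a) : ℝ)) *
      (qPochInf (Complex.exp (2 * Complex.I * r * z))⁻¹ (Real.exp (-2 * r * a) : ℝ) /
        qPochInf ((Real.exp (-2 * r * b) : ℝ) * (Complex.exp (2 * Complex.I * r * z))⁻¹)
          (Real.exp (-2 * r * a) : ℝ)) := by
  have hexp (z : ℂ) : Complex.exp (2 * Complex.I * r * (z + Complex.I * b)) =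
      (Real.exp (-2 * r * b) : ℝ) * Complex.exp (2 * Complex.I * r * z) := by
    rw [Complex.ofReal_exp, ← Complex.exp_add]
    congr 1
    push_cast
    linear_combination (2 * r * b : ℂ) * Complex.I_sq
  rw [wFun, trigGamma_sub h, trigGamma_sub h, trigGamma_sub h, trigGamma_sub h, hexp, hexp,
    mul_neg, Complex.exp_neg]
  simp only [div_eq_mul_inv, mul_inv, inv_inv]
  ring

/-- For real arguments the weight function is a nonnegative real number. -/
lemma exists_wFun_eq {r a : ℝ} (h : 0 < r * a) (b x : ℝ) :
    ∃ c : ℝ, 0 ≤ c ∧ wFun r a b x = c := by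
  have hq := norm_ofReal_lt_one (Real.exp_pos (-2 * r * a)) (Real.exp_lt_one_iff.2 (by linarith))
  have hconj : (Complex.exp (2 * Complex.I * r * x))⁻¹ =
      starRingEnd ℂ (Complex.exp (2 * Complex.I * r * x)) := by
    rw [← Complex.exp_conj, ← Complex.exp_neg]
    simp [Complex.conj_ofNat]
  refine ⟨Complex.normSq (qPochInf (Complex.exp (2 * Complex.I * r * x))
      (Real.exp (-2 * r * a) : ℝ) /
    qPochInf ((Real.exp (-2 * r * b) : ℝ) * Complex.exp (2 * Complex.I * r * x))
      (Real.exp (-2 * r * a) : ℝ)), Complex.normSq_nonneg _, ?_⟩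
  rw [wFun_eq h, ← Complex.mul_conj, map_div₀, conj_qPochInf _ _ hq, conj_qPochInf _ _ hq,
    map_mul, Complex.conj_ofReal, hconj]

lemma prod_prod_ite_ne {M : Type*} [CommMonoid M] {N : ℕ} (f : Fin N → Fin N → M) :
    (∏ i, ∏ j, if i ≠ j then f i j else 1) =
      ∏ i, ∏ j, if i < j then f i j * f j i else 1 := by
  have hsplit (i j : Fin N) : (if i ≠ j then f i j else 1) =
      (if i < j then f i j else 1) * (if j < i then f i j else 1) := by
    rcases lt_trichotomy i j with h | h | h
    · simp [h.ne, h, h.not_gt]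
    · simp [h]
    · simp [h.ne', h, h.not_gt]
  have hmul (i j : Fin N) : (if i < j then f i j * f j i else 1) =
      (if i < j then f i j else 1) * (if i < j then f j i else 1) := by
    split_ifs <;> simp
  simp only [hsplit, hmul, prod_mul_distrib]
  congr 1
  exact prod_comm

lemma prod_prod_const_mul {M : Type*} [CommMonoid M] {n m : ℕ} (c : M) (f : Fin n → Fin m → M) :
    (∏ i, ∏ j, c * f i j) = c ^ (n * m) * ∏ i, ∏ j, f i j := by
  simp only [prod_mul_distrib, prod_const, card_univ, Fintype.card_fin]
  rw [← pow_mul, mul_comm m n]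

/-- The square of the square-root factor of `Ψ₀` is the weight function `Δ_N`. -/
lemma sqrt_prod_wFun_mul_self {N : ℕ} {r a : ℝ} (h : 0 < r * a) (b : ℝ) (s : Fin N → ℝ) (z : Fin N → ℂ)
    (hz : ∀ i j, z i / z j = Complex.exp (2 * Complex.I * r * (s i - s j : ℝ))) :
    ((Real.sqrt (∏ i, ∏ j, if i < j then (wFun r a b (s i - s j)).re else 1) : ℝ) : ℂ) *
      ((Real.sqrt (∏ i, ∏ j, if i < j then (wFun r a b (s i - s j)).re else 1) : ℝ) : ℂ) =
      DeltaW (Real.exp (-2 * r * a) : ℝ) (Real.exp (-2 * r * b) : ℝ) z := by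
  rw [← Complex.ofReal_mul, Real.mul_self_sqrt, DeltaW, prod_prod_ite_ne]
  · push_cast
    refine prod_congr rfl fun i _ => prod_congr rfl fun j _ => ?_
    split_ifs with hij
    · obtain ⟨c, -, hc⟩ := exists_wFun_eq h b (s i - s j)
      rw [← Complex.ofReal_sub, hc, Complex.ofReal_re, ← hc, wFun_eq h, ← inv_div (z i) (z j), hz]
      push_cast
      rfl
    · rfl
  · refine prod_nonneg fun i _ => prod_nonneg fun j _ => ?_
    split_ifs
    · obtain ⟨c, hc₀, hc⟩ := exists_wFun_eq h b (s i - s j)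
      rwa [← Complex.ofReal_sub, hc, Complex.ofReal_re]
    · exact zero_le_one

lemma two_sin_mul_two_sin (A B : ℂ) :
    (2 * Complex.sin (A + B)) * (2 * Complex.sin (A - B)) =
      (Complex.exp (2 * Complex.I * B))⁻¹ *
        ((1 - Complex.exp (2 * Complex.I * B) * Complex.exp (2 * Complex.I * A)) *
          (1 - Complex.exp (2 * Complex.I * B) * (Complex.exp (2 * Complex.I * A))⁻¹)) := by
  have hsq (w : ℂ) : Complex.exp (2 * Complex.I * w) = Complex.exp (w * Complex.I) ^ 2 := by
    rw [← Complex.exp_nat_mul]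
    congr 1
    push_cast
    ring
  have hA := Complex.exp_ne_zero (A * Complex.I)
  have hB := Complex.exp_ne_zero (B * Complex.I)
  rw [hsq, hsq, Complex.sin, Complex.sin]
  simp only [add_mul, sub_mul, neg_mul, neg_add, neg_sub, Complex.exp_add, Complex.exp_sub,
    Complex.exp_neg]
  generalize Complex.exp (A * Complex.I) = a at hA ⊢
  generalize Complex.exp (B * Complex.I) = b at hB ⊢
  field_simp
  linear_combination (a ^ 2 - b ^ 2) * (a ^ 2 * b ^ 2 - 1) * Complex.I_sq

lemma isAddFundamentalDomain_pi_Ioc {ι : Type*} [Fintype ι] {T : ℝ} (hT : 0 < T) (a : ℝ) :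
    IsAddFundamentalDomain
      (AddSubgroup.pi Set.univ fun _ : ι => AddSubgroup.zmultiples T)
      (Set.univ.pi fun _ : ι => Set.Ioc a (a + T)) := by
  refine .mk' (MeasurableSet.univ_pi fun _ => measurableSet_Ioc).nullMeasurableSet fun x => ?_
  choose k hk hk' using fun i => existsUnique_add_zsmul_mem_Ioc hT (x i) a
  refine ⟨⟨fun i => k i • T, fun i _ => AddSubgroup.mem_zmultiples_iff.2 ⟨k i, rfl⟩⟩,
    fun i _ => ?_, ?_⟩
  · simpa [AddSubgroup.vadd_def, add_comm] using hk i
  · rintro ⟨g, hg⟩ hgx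
    ext i
    obtain ⟨l, hl⟩ := AddSubgroup.mem_zmultiples_iff.1 (hg i trivial)
    have hmem : g i + x i ∈ Set.Ioc a (a + T) := hgx i trivial
    rw [add_comm (g i), ← hl] at hmem
    change g i = k i • T
    rw [← hl, hk' i l hmem]

instance countable_pi_zmultiples {ι : Type*} [Finite ι] (T : ℝ) :
    Countable (AddSubgroup.pi Set.univ fun _ : ι => AddSubgroup.zmultiples T) := by
  have hsub : ((AddSubgroup.pi Set.univ fun _ : ι => AddSubgroup.zmultiples T :
      AddSubgroup (ι → ℝ)) : Set (ι → ℝ)) ⊆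
      Set.range fun (k : ι → ℤ) i => k i • T := fun g hg => by
    choose k hk using fun i => AddSubgroup.mem_zmultiples_iff.1 (hg i trivial)
    exact ⟨k, funext hk⟩
  exact ((Set.countable_range _).mono hsub).to_subtype

open scoped Pointwise in
/-- Rescaling an integral over the cube `[-L/2, L/2]^N` of a function of `2πs/L`, where the
integrand is `2π`-periodic in each variable. -/
lemma setIntegral_cube_eq {N : ℕ} {L : ℝ} (hL : 0 < L) (f : (Fin N → ℝ) → ℂ)
    (hf : ∀ (k : Fin N → ℤ) θ, f ((fun i => k i • (2 * Real.pi)) + θ) = f θ) :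
    ∫ s in Set.univ.pi fun _ : Fin N => Set.Icc (-(L / 2)) (L / 2), f ((2 * Real.pi / L) • s) =
      (L / (2 * Real.pi)) ^ N *
        ∫ θ in Set.univ.pi fun _ : Fin N => Set.Ioc (0 : ℝ) (2 * Real.pi), f θ := by
  have hR : 0 < 2 * Real.pi / L := by positivity
  have hset : (2 * Real.pi / L) • (Set.univ.pi fun _ : Fin N => Set.Ioc (-(L / 2)) (L / 2)) =
      Set.univ.pi fun _ : Fin N => Set.Ioc (-Real.pi) (-Real.pi + 2 * Real.pi) := by
    rw [Set.smul_set_pi₀' (Or.inl hR.ne')]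
    congr 1
    ext1 i
    simp only [Pi.smul_apply]
    rw [LinearOrderedField.smul_Ioc hR]
    congr 1 <;> field_simp
    ring
  have hpi := isAddFundamentalDomain_pi_Ioc (ι := Fin N) Real.two_pi_pos
  have hper := (hpi (-Real.pi)).setIntegral_eq (hpi 0) (f := f) fun g x => by
    choose k hk using fun i => AddSubgroup.mem_zmultiples_iff.1 (g.2 i trivial)
    have hg : (g : Fin N → ℝ) = fun i => k i • (2 * Real.pi) := (funext hk).symm
    rw [AddSubgroup.vadd_def, vadd_eq_add, hg, hf]
  have hIcc := Measure.univ_pi_Ioc_ae_eq_Icc (μ := fun _ : Fin N => (volume : Measure ℝ))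
    (f := fun _ => -(L / 2)) (g := fun _ => L / 2)
  rw [← Set.pi_univ_Icc, ← volume_pi] at hIcc
  rw [← setIntegral_congr_set hIcc, Measure.setIntegral_comp_smul_of_pos _ _ _ hR, hset, hper,
    zero_add, Module.finrank_fin_fun, ← inv_pow, inv_div, Complex.real_smul]
  push_cast
  rfl

/-- The product of the groundstate factors is the weight function `Δ_{n,m}` up to a constant. -/
lemma Psi0_mul_conj_Psi0 {n m : ℕ} {L β γ : ℝ} (hL : 0 < L) (hβ : 0 < β) (hγ : 0 < γ)
    (ε ε' : ℝ) (s : Fin n → ℝ) (r : Fin m → ℝ) :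
    Psi0 n m L β γ (fun i => s i + Complex.I * ε) (fun j => r j + Complex.I * ε') *
      starRingEnd ℂ (Psi0 n m L β γ (fun i => s i - Complex.I * ε)
        (fun j => r j - Complex.I * ε')) =
      (Real.exp (n * m * Real.pi * (β - γ) / L) : ℂ) *
        DeltaNM n m (Real.exp (-2 * Real.pi * β / L)) (Real.exp (-2 * Real.pi * γ / L))
          (fun i => Complex.exp (2 * Real.pi * Complex.I * (s i + Complex.I * ε) / L))
          (fun j => Complex.exp (2 * Real.pi * Complex.I * (r j + Complex.I * ε') / L)) := by
  have hparam (b : ℝ) : -2 * Real.pi * b / L = -2 * (Real.pi / L) * b := by ring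
  have hratio {N : ℕ} (e : ℝ) (s : Fin N → ℝ) (i j : Fin N) :
      Complex.exp (2 * Real.pi * Complex.I * (s i + Complex.I * e) / L) /
        Complex.exp (2 * Real.pi * Complex.I * (s j + Complex.I * e) / L) =
      Complex.exp (2 * Complex.I * (Real.pi / L : ℝ) * (s i - s j : ℝ)) := by
    rw [← Complex.exp_sub]
    congr 1
    push_cast
    ring
  have hx := sqrt_prod_wFun_mul_self (by positivity : 0 < Real.pi / L * β) γ s _ (hratio ε s)
  have hy := sqrt_prod_wFun_mul_self (by positivity : 0 < Real.pi / L * γ) β r _ (hratio ε' r)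
  set c : ℂ := ((Real.exp (Real.pi * (β - γ) / L) : ℝ) : ℂ) with hc
  have hc_sqrt : (Real.sqrt (Real.exp (-2 * Real.pi * β / L)) : ℂ)⁻¹ *
      (Real.sqrt (Real.exp (-2 * Real.pi * γ / L)) : ℂ) = c := by
    rw [← Real.exp_half, ← Real.exp_half, ← Complex.ofReal_inv, ← Real.exp_neg,
      ← Complex.ofReal_mul, ← Real.exp_add, hc]
    congr 2
    ring
  have hc_pow : (Real.exp (n * m * Real.pi * (β - γ) / L) : ℂ) = c ^ (n * m) := by
    rw [hc, ← Complex.ofReal_pow, ← Real.exp_nat_mul]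
    congr 2
    push_cast
    ring
  have hfactor (i : Fin n) (j : Fin m) :
      (2 * Complex.sin (Real.pi * ((s i + Complex.I * ε) - (r j + Complex.I * ε') +
          Complex.I * γ / 2 - Complex.I * β / 2) / L)) *
        starRingEnd ℂ (2 * Complex.sin (Real.pi * ((s i - Complex.I * ε) -
          (r j - Complex.I * ε') + Complex.I * γ / 2 - Complex.I * β / 2) / L)) =
      c⁻¹ * ((1 - c * (Complex.exp (2 * Real.pi * Complex.I * (s i + Complex.I * ε) / L) /
          Complex.exp (2 * Real.pi * Complex.I * (r j + Complex.I * ε') / L))) *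
        (1 - c * (Complex.exp (2 * Real.pi * Complex.I * (r j + Complex.I * ε') / L) /
          Complex.exp (2 * Real.pi * Complex.I * (s i + Complex.I * ε) / L)))) := by
    have key := two_sin_mul_two_sin
      (Real.pi * ((s i + Complex.I * ε) - (r j + Complex.I * ε')) / L)
      (Real.pi * (Complex.I * γ / 2 - Complex.I * β / 2) / L)
    have hcB : Complex.exp (2 * Complex.I *
        (Real.pi * (Complex.I * γ / 2 - Complex.I * β / 2) / L)) = c := by
      rw [hc, Complex.ofReal_exp]
      congr 1
      push_cast
      linear_combination (Real.pi * (γ - β) / L : ℂ) * Complex.I_sq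
    have hZ : Complex.exp (2 * Complex.I *
        (Real.pi * ((s i + Complex.I * ε) - (r j + Complex.I * ε')) / L)) =
        Complex.exp (2 * Real.pi * Complex.I * (s i + Complex.I * ε) / L) /
          Complex.exp (2 * Real.pi * Complex.I * (r j + Complex.I * ε') / L) := by
      rw [← Complex.exp_sub]
      congr 1
      ring
    rw [hcB, hZ, inv_div] at key
    rw [← key, map_mul, ← Complex.sin_conj, Complex.conj_ofNat]
    congr 3
    · ring
    · simp only [map_div₀, map_mul, map_sub, map_add, Complex.conj_ofReal, Complex.conj_I,
        Complex.conj_ofNat]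
      ring
  rw [DeltaNM, hc_pow, hc_sqrt, hparam, hparam, ← hx, ← hy, Psi0, Psi0]
  simp only [add_sub_add_right_eq_sub, sub_sub_sub_cancel_right, map_div₀, map_mul,
    Complex.conj_ofReal]
  simp only [map_prod, div_mul_div_comm, ← prod_mul_distrib]
  simp only [hfactor, prod_prod_const_mul, inv_pow]
  rw [div_mul_eq_div_div, div_inv_eq_mul]
  ring

theorem statement6 (n m : ℕ) (hn : 1 ≤ n) (hm : 1 ≤ m) (L β γ : ℝ)
    (hL : 0 < L) (hβ : 0 < β) (hγ : 0 < γ) (ε ε' : ℝ)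
    (hsep : |ε - ε'| > |γ - β| / 2)
    (P Q : (Fin n → ℂ) → (Fin m → ℂ) → ℂ)
    (hP : InLambda n m (Real.exp (-2 * Real.pi * β / L)) (Real.exp (-2 * Real.pi * γ / L)) P)
    (hQ : InLambda n m (Real.exp (-2 * Real.pi * β / L)) (Real.exp (-2 * Real.pi * γ / L)) Q) :
    (∫ s in Set.univ.pi fun _ : Fin n => Set.Icc (-(L / 2)) (L / 2),
        ∫ r in Set.univ.pi fun _ : Fin m => Set.Icc (-(L / 2)) (L / 2),
          PsiWave n m L β γ P (fun i => (s i : ℂ) + Complex.I * (ε : ℂ))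
              (fun j => (r j : ℂ) + Complex.I * (ε' : ℂ)) *
            starRingEnd ℂ (PsiWave n m L β γ Q (fun i => (s i : ℂ) - Complex.I * (ε : ℂ))
              (fun j => (r j : ℂ) - Complex.I * (ε' : ℂ)))) =
      (n.factorial : ℂ) * (m.factorial : ℂ) * (L : ℂ) ^ (n + m) *
        (Real.exp (n * m * Real.pi * (β - γ) / L) : ℂ) *
        pairingNM n m (Real.exp (-2 * Real.pi * β / L)) (Real.exp (-2 * Real.pi * γ / L)) P Q
          (Real.exp (-2 * Real.pi * ε / L)) (Real.exp (-2 * Real.pi * ε' / L)) := by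
  set G : (Fin n → ℝ) → (Fin m → ℝ) → ℂ := fun θ φ =>
    DeltaNM n m (Real.exp (-2 * Real.pi * β / L)) (Real.exp (-2 * Real.pi * γ / L))
        (fun i => (Real.exp (-2 * Real.pi * ε / L) : ℂ) * Complex.exp (Complex.I * (θ i : ℂ)))
        (fun j => (Real.exp (-2 * Real.pi * ε' / L) : ℂ) * Complex.exp (Complex.I * (φ j : ℂ))) *
      P (fun i => (Real.exp (-2 * Real.pi * ε / L) : ℂ) * Complex.exp (Complex.I * (θ i : ℂ)))
        (fun j => (Real.exp (-2 * Real.pi * ε' / L) : ℂ) * Complex.exp (Complex.I * (φ j : ℂ))) *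
      starFun Q
        (fun i => (Real.exp (-2 * Real.pi * ε / L) : ℂ) * Complex.exp (Complex.I * (θ i : ℂ)))
        (fun j => (Real.exp (-2 * Real.pi * ε' / L) : ℂ) * Complex.exp (Complex.I * (φ j : ℂ)))
    with hG
  have hpolar (e s : ℝ) : Complex.exp (2 * Real.pi * Complex.I * (s + Complex.I * e) / L) =
      (Real.exp (-2 * Real.pi * e / L) : ℂ) *
        Complex.exp (Complex.I * (2 * Real.pi / L * s : ℝ)) := by
    rw [Complex.ofReal_exp, ← Complex.exp_add]
    congr 1
    push_cast
    linear_combination (2 * Real.pi * e / L : ℂ) * Complex.I_sq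
  have hpolar_conj (e s : ℝ) : Complex.exp (2 * Real.pi * Complex.I * (s - Complex.I * e) / L) =
      (starRingEnd ℂ ((Real.exp (-2 * Real.pi * e / L) : ℂ) *
        Complex.exp (Complex.I * (2 * Real.pi / L * s : ℝ))))⁻¹ := by
    rw [← hpolar, ← Complex.exp_conj, ← Complex.exp_neg]
    congr 1
    simp only [map_div₀, map_mul, map_add, Complex.conj_ofReal, Complex.conj_I,
      Complex.conj_ofNat]
    ring
  have hper {N : ℕ} (k : Fin N → ℤ) (θ : Fin N → ℝ) (i : Fin N) :
      Complex.exp (Complex.I * (((fun i => k i • (2 * Real.pi)) + θ) i : ℝ)) =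
        Complex.exp (Complex.I * (θ i : ℝ)) := by
    rw [Complex.exp_eq_exp_iff_exists_int]
    refine ⟨k i, ?_⟩
    simp only [Pi.add_apply, zsmul_eq_mul]
    push_cast
    ring
  have hint (s : Fin n → ℝ) (r : Fin m → ℝ) :
      PsiWave n m L β γ P (fun i => (s i : ℂ) + Complex.I * (ε : ℂ))
          (fun j => (r j : ℂ) + Complex.I * (ε' : ℂ)) *
        starRingEnd ℂ (PsiWave n m L β γ Q (fun i => (s i : ℂ) - Complex.I * (ε : ℂ))
          (fun j => (r j : ℂ) - Complex.I * (ε' : ℂ))) =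
      (Real.exp (n * m * Real.pi * (β - γ) / L) : ℂ) *
        G ((2 * Real.pi / L) • s) ((2 * Real.pi / L) • r) := by
    have key := Psi0_mul_conj_Psi0 hL hβ hγ ε ε' s r
    simp only [hpolar] at key
    simp only [hG, PsiWave, starFun, map_mul, hpolar, hpolar_conj, Pi.smul_apply, smul_eq_mul]
      at key ⊢
    linear_combination (P _ _ * starRingEnd ℂ (Q _ _)) * key
  have hinner (θ : Fin n → ℝ) := setIntegral_cube_eq hL (G θ) fun k φ => by
    simp only [hG, hper]
  have houter := setIntegral_cube_eq hL
    (fun θ => ∫ φ in Set.univ.pi fun _ : Fin m => Set.Ioc (0 : ℝ) (2 * Real.pi), G θ φ)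
    fun k θ => by simp only [hG, hper]
  have hpair : pairingNM n m (Real.exp (-2 * Real.pi * β / L)) (Real.exp (-2 * Real.pi * γ / L)) P Q
      (Real.exp (-2 * Real.pi * ε / L)) (Real.exp (-2 * Real.pi * ε' / L)) =
      (1 / ((n.factorial : ℂ) * (m.factorial : ℂ))) * (1 / (2 * (Real.pi : ℂ)) ^ (n + m)) *
        ∫ θ in Set.univ.pi fun _ : Fin n => Set.Ioc (0 : ℝ) (2 * Real.pi),
          ∫ φ in Set.univ.pi fun _ : Fin m => Set.Ioc (0 : ℝ) (2 * Real.pi), G θ φ := rfl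
  simp only [hint, integral_const_mul, hinner, houter, hpair]
  have hn₀ : (n.factorial : ℂ) ≠ 0 := Nat.cast_ne_zero.2 n.factorial_ne_zero
  have hm₀ : (m.factorial : ℂ) ≠ 0 := Nat.cast_ne_zero.2 m.factorial_ne_zero
  have hπ : (Real.pi : ℂ) ≠ 0 := Complex.ofReal_ne_zero.2 Real.pi_ne_zero
  rw [div_pow, div_pow, pow_add, pow_add]
  field_simp
end
end

section
/- Let 0 < q < t < 1, and let f(x,y) be a Laurent polynomial in two variables with complex coefficients. For ρ,ρ′ > 0 with ρ/ρ′ ∉ {(q/t)^{1/2}, (t/q)^{1/2}}, define I(ρ,ρ′) := ∮_{|x|=ρ} dx/(2πi x) ∮_{|y|=ρ′} dy/(2πi y) f(x,y)/[(1 − q^{−1/2} t^{1/2} x/y)(1 − q^{−1/2} t^{1/2} y/x)]. Then for all ξ,ξ′ > 0 with ξ/ξ′ > q^{−1/2} t^{1/2}: I(ξ,ξ′) = I(ξ,ξ) + (q/(q−t)) ∮_{|x|=ξ} f(x, q^{1/2} t^{−1/2} x) dx/(2πi x). -/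
open Complex MeasureTheory Finset

noncomputable section

/-- The circle integral `∮_{|z|=ρ} F(z) dz/(2πiz) = (1/2π) ∫_0^{2π} F(ρ e^{iθ}) dθ`. -/
def circleAvg (ρ : ℝ) (F : ℂ → ℂ) : ℂ :=
  (1 / (2 * (Real.pi : ℂ))) *
    ∫ θ in (0 : ℝ)..(2 * Real.pi), F ((ρ : ℂ) * Complex.exp ((θ : ℂ) * Complex.I))

/-- The double contour integral `I(ρ,ρ′)` from the `n = m = 1` case. -/
def I11 (q t : ℝ) (f : ℂ → ℂ → ℂ) (ρ ρ' : ℝ) : ℂ :=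
  circleAvg ρ fun x => circleAvg ρ' fun y =>
    f x y / ((1 - (Real.sqrt q : ℂ)⁻¹ * (Real.sqrt t : ℂ) * (x / y)) *
      (1 - (Real.sqrt q : ℂ)⁻¹ * (Real.sqrt t : ℂ) * (y / x)))


theorem circleAvg_eq_circleIntegral {ρ : ℝ} (hρ : ρ ≠ 0) (F : ℂ → ℂ) :
    circleAvg ρ F = (2 * (Real.pi : ℂ) * I)⁻¹ * ∮ z in C(0, ρ), z⁻¹ * F z := by
  have hint : (∮ z in C(0, ρ), z⁻¹ * F z) =
      I * ∫ θ in (0 : ℝ)..(2 * Real.pi), F ((ρ : ℂ) * Complex.exp ((θ : ℂ) * I)) := by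
    rw [circleIntegral, ← intervalIntegral.integral_const_mul]
    congr 1
    funext θ
    have hne : (ρ : ℂ) * Complex.exp ((θ : ℂ) * I) ≠ 0 :=
      mul_ne_zero (by exact_mod_cast hρ) (Complex.exp_ne_zero _)
    simp only [deriv_circleMap, circleMap, zero_add, smul_eq_mul]
    generalize (ρ : ℂ) * Complex.exp ((θ : ℂ) * I) = w at hne ⊢
    field_simp
  rw [hint, circleAvg, ← mul_assoc, mul_inv, inv_mul_cancel_right₀ Complex.I_ne_zero, one_div]

theorem circleAvg_congr {ρ : ℝ} (hρ : 0 ≤ ρ) {F G : ℂ → ℂ} (h : ∀ z, ‖z‖ = ρ → F z = G z) :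
    circleAvg ρ F = circleAvg ρ G := by
  unfold circleAvg
  congr 2
  funext θ
  apply h
  simp [Complex.norm_exp_ofReal_mul_I, abs_of_nonneg hρ]

theorem circleAvg_add {ρ : ℝ} {F G : ℂ → ℂ}
    (hF : Continuous fun θ : ℝ => F ((ρ : ℂ) * Complex.exp ((θ : ℂ) * I)))
    (hG : Continuous fun θ : ℝ => G ((ρ : ℂ) * Complex.exp ((θ : ℂ) * I))) :
    circleAvg ρ (fun z => F z + G z) = circleAvg ρ F + circleAvg ρ G := by
  unfold circleAvg
  rw [intervalIntegral.integral_add (hF.intervalIntegrable _ _) (hG.intervalIntegrable _ _),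
    mul_add]

theorem circleAvg_const_mul (ρ : ℝ) (c : ℂ) (F : ℂ → ℂ) :
    circleAvg ρ (fun z => c * F z) = c * circleAvg ρ F := by
  unfold circleAvg
  rw [intervalIntegral.integral_const_mul]
  ring

theorem continuous_circle (ρ : ℝ) :
    Continuous fun θ : ℝ => (ρ : ℂ) * Complex.exp ((θ : ℂ) * I) := by fun_prop

theorem continuous_comp_circle {ρ : ℝ} (hρ : 0 ≤ ρ) {F : ℂ → ℂ}
    (hF : ContinuousOn F (Metric.sphere 0 ρ)) :
    Continuous fun θ : ℝ => F ((ρ : ℂ) * Complex.exp ((θ : ℂ) * I)) :=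
  hF.comp_continuous (continuous_circle ρ) fun θ => by
    simp [Complex.norm_exp_ofReal_mul_I, abs_of_nonneg hρ]

theorem sub_ne_zero_of_norm_ne {z a : ℂ} (h : ‖z‖ ≠ ‖a‖) : z - a ≠ 0 :=
  fun h0 => h (by rw [sub_eq_zero.1 h0])

theorem circleAvg_inv_one_sub_div {r : ℝ} (hr : 0 < r) {a : ℂ} (ha : a ≠ 0) (hne : r ≠ ‖a‖) :
    circleAvg r (fun y => (1 - y / a)⁻¹) =
      1 - (2 * (Real.pi : ℂ) * I)⁻¹ * ∮ z in C(0, r), (z - a)⁻¹ := by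
  have hEq : (∮ z in C(0, r), z⁻¹ * (1 - z / a)⁻¹) = ∮ z in C(0, r), (z⁻¹ - (z - a)⁻¹) := by
    apply circleIntegral.integral_congr hr.le
    intro z hz
    have hz' : ‖z‖ = r := by simpa using hz
    have h0 : z ≠ 0 := by rw [← norm_pos_iff, hz']; exact hr
    have h1 : z - a ≠ 0 := sub_ne_zero_of_norm_ne (by rwa [hz'])
    have h2 : a - z ≠ 0 := by rw [← neg_sub]; exact neg_ne_zero.2 h1
    have h3 : (1 - z / a) = (a - z) / a := by field_simp
    simp only [h3]
    field_simp
    ring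
  have hcz : ContinuousOn (fun z : ℂ => z⁻¹) (Metric.sphere 0 r) :=
    continuousOn_id.inv₀ fun z hz => by
      have hz' : ‖z‖ = r := by simpa using hz
      rw [id, ← norm_pos_iff, hz']; exact hr
  have hca : ContinuousOn (fun z : ℂ => (z - a)⁻¹) (Metric.sphere 0 r) :=
    (continuousOn_id.sub continuousOn_const).inv₀ fun z hz => by
      have hz' : ‖z‖ = r := by simpa using hz
      exact sub_ne_zero_of_norm_ne (by simpa [hz'] using hne)
  have hz : (∮ z in C(0, r), z⁻¹) = 2 * Real.pi * I := by
    simpa using circleIntegral.integral_sub_center_inv (0 : ℂ) hr.ne'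
  rw [circleAvg_eq_circleIntegral hr.ne', hEq,
    circleIntegral.integral_sub (hcz.circleIntegrable hr.le) (hca.circleIntegrable hr.le),
    hz, mul_sub, inv_mul_cancel₀ Complex.two_pi_I_ne_zero]

theorem circleAvg_inv_one_sub_div_of_lt {r : ℝ} (hr : 0 < r) {a : ℂ} (hra : r < ‖a‖) :
    circleAvg r (fun y => (1 - y / a)⁻¹) = 1 := by
  have ha : a ≠ 0 := norm_pos_iff.1 (hr.trans hra)
  have hd : DifferentiableOn ℂ (fun z : ℂ => (z - a)⁻¹) (Metric.closedBall 0 r) := by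
    intro z hz
    have hz' : ‖z‖ ≤ r := by simpa using hz
    have : z - a ≠ 0 := sub_ne_zero_of_norm_ne (hz'.trans_lt hra).ne
    exact ((differentiableAt_id.sub_const a).inv this).differentiableWithinAt
  rw [circleAvg_inv_one_sub_div hr ha hra.ne]
  have h0 : (∮ z in C(0, r), (z - a)⁻¹) = 0 :=
    (hd.diffContOnCl_ball subset_rfl).circleIntegral_eq_zero hr.le
  rw [h0]; simp

theorem circleAvg_inv_one_sub_div_of_gt {r : ℝ} {a : ℂ} (ha : a ≠ 0) (hra : ‖a‖ < r) :
    circleAvg r (fun y => (1 - y / a)⁻¹) = 0 := by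
  rw [circleAvg_inv_one_sub_div ((norm_nonneg a).trans_lt hra) ha hra.ne',
    circleIntegral.integral_sub_inv_of_mem_ball (by simpa using hra),
    inv_mul_cancel₀ Complex.two_pi_I_ne_zero, sub_self]

/-- Shifting the radius across a simple pole at `a` picks up the residue `h a`. -/
theorem circleAvg_div_one_sub_div_eq_add {r R : ℝ} {a : ℂ} {h : ℂ → ℂ} {U : Set ℂ}
    (hU : IsOpen U) (hr : 0 < r) (hra : r < ‖a‖) (haR : ‖a‖ < R)
    (hsub : ∀ z, r ≤ ‖z‖ → ‖z‖ ≤ R → z ∈ U) (hd : DifferentiableOn ℂ h U) :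
    circleAvg r (fun y => h y / (1 - y / a)) = circleAvg R (fun y => h y / (1 - y / a)) + h a := by
  have ha : a ≠ 0 := norm_pos_iff.1 (hr.trans hra)
  have hR : 0 < R := (hr.trans hra).trans haR
  have hds : DifferentiableOn ℂ (dslope h a) U :=
    (Complex.differentiableOn_dslope (hU.mem_nhds (hsub a hra.le haR.le))).2 hd
  have hann : circleAvg R (dslope h a) = circleAvg r (dslope h a) := by
    rw [circleAvg_eq_circleIntegral hR.ne', circleAvg_eq_circleIntegral hr.ne']
    congr 1
    simpa using
      Complex.circleIntegral_sub_center_inv_smul_eq_of_differentiable_on_annulus_off_countable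
        (c := (0 : ℂ)) hr (hra.trans haR).le Set.countable_empty
        (hds.continuousOn.mono fun z hz => by
          simp only [Set.mem_sdiff, Metric.mem_closedBall, Metric.mem_ball, dist_zero_right,
            not_lt] at hz
          exact hsub z hz.2 hz.1)
        (fun z hz => by
          simp only [Set.mem_sdiff, Metric.mem_closedBall, Metric.mem_ball, dist_zero_right,
            not_le] at hz
          exact hds.differentiableAt (hU.mem_nhds (hsub z hz.1.2.le hz.1.1.le)))
  have key : ∀ ρ, r ≤ ρ → ρ ≤ R → ρ ≠ ‖a‖ → circleAvg ρ (fun y => h y / (1 - y / a)) =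
      -a * circleAvg ρ (dslope h a) + h a * circleAvg ρ (fun y => (1 - y / a)⁻¹) := by
    intro ρ h1 h2 hne
    have hρ : 0 ≤ ρ := hr.le.trans h1
    have hden : ∀ z : ℂ, ‖z‖ = ρ → (1 - z / a) ≠ 0 := by
      intro z hz h0
      apply hne
      rw [← hz, (div_eq_one_iff_eq ha).1 (sub_eq_zero.1 h0).symm]
    rw [← circleAvg_const_mul, ← circleAvg_const_mul, ← circleAvg_add]
    · apply circleAvg_congr hρ
      intro z hz
      have hza : z - a ≠ 0 := sub_ne_zero_of_norm_ne (by rwa [hz])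
      have h3 : (1 - z / a) = -(z - a) / a := by field_simp; ring
      rw [dslope_of_ne _ (sub_ne_zero.1 hza), slope_def_field, h3]
      field_simp
      ring
    · refine continuous_comp_circle hρ (F := fun z => -a * dslope h a z)
        (continuousOn_const.mul (hds.continuousOn.mono fun z hz => ?_))
      have hz' : ‖z‖ = ρ := by simpa using hz
      exact hsub z (by rwa [hz']) (by rwa [hz'])
    · refine continuous_comp_circle hρ (F := fun z => h a * (1 - z / a)⁻¹)
        (continuousOn_const.mul (ContinuousOn.inv₀ (by fun_prop) fun z hz => hden z ?_))
      simpa using hz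
  rw [key r le_rfl (hra.trans haR).le hra.ne, key R (hra.trans haR).le le_rfl haR.ne', hann,
    circleAvg_inv_one_sub_div_of_lt hr hra, circleAvg_inv_one_sub_div_of_gt ha haR]
  ring

theorem one_sub_mul_div_ne_zero {s : ℝ} (hs : 1 < s) {x y : ℂ} (hy : y ≠ 0)
    (h : ‖y‖ < s * ‖x‖) : 1 - (s : ℂ) * (x / y) ≠ 0 := by
  intro h0
  have h1 : y = s * x := by
    have h2 : (s : ℂ) * (x / y) = 1 := (sub_eq_zero.1 h0).symm
    field_simp at h2
    exact h2.symm
  rw [h1, norm_mul, Complex.norm_real, Real.norm_of_nonneg (by linarith)] at h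
  exact lt_irrefl _ h

theorem circleAvg_kernel_eq_add {s ξ ξ' : ℝ} (hs : 1 < s) (hξ' : 0 < ξ') (hlt : s * ξ' < ξ)
    {g : ℂ → ℂ} (hg : DifferentiableOn ℂ g {0}ᶜ) {x : ℂ} (hx : ‖x‖ = ξ) :
    circleAvg ξ' (fun y => g y / ((1 - (s : ℂ) * (x / y)) * (1 - (s : ℂ) * (y / x)))) =
      circleAvg ξ (fun y => g y / ((1 - (s : ℂ) * (x / y)) * (1 - (s : ℂ) * (y / x)))) +
        (1 - (s : ℂ) ^ 2)⁻¹ * g ((s : ℂ)⁻¹ * x) := by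
  have hs0 : 0 < s := by linarith
  have hsC : (s : ℂ) ≠ 0 := by exact_mod_cast hs0.ne'
  have hξ : 0 < ξ := by nlinarith
  have hx0 : x ≠ 0 := by rw [← norm_pos_iff, hx]; exact hξ
  have hna : ‖(s : ℂ)⁻¹ * x‖ = ξ / s := by
    rw [norm_mul, norm_inv, Complex.norm_real, Real.norm_of_nonneg hs0.le, hx]
    field_simp
  have hopen : IsOpen ({0}ᶜ ∩ Metric.ball 0 (s * ξ) : Set ℂ) :=
    isOpen_compl_singleton.inter Metric.isOpen_ball
  have hd : DifferentiableOn ℂ (fun y => g y / (1 - (s : ℂ) * (x / y)))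
      ({0}ᶜ ∩ Metric.ball 0 (s * ξ)) := by
    apply (hg.mono Set.inter_subset_left).div
    · exact (differentiableOn_const _).sub
        ((differentiableOn_const _).mul
          ((differentiableOn_const _).div differentiableOn_id fun y hy => hy.1))
    · intro y hy
      exact one_sub_mul_div_ne_zero hs hy.1 (by simpa [hx] using hy.2)
  have main := circleAvg_div_one_sub_div_eq_add (r := ξ') (R := ξ) (a := (s : ℂ)⁻¹ * x) hopen hξ'
    (by rw [hna, lt_div_iff₀ hs0]; linarith)
    (by rw [hna, div_lt_iff₀ hs0]; nlinarith)
    (fun z h1 h2 => ⟨norm_pos_iff.1 (hξ'.trans_le h1), by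
      simp only [Metric.mem_ball, dist_zero_right]; nlinarith⟩) hd
  have hrw : ∀ y : ℂ, g y / ((1 - (s : ℂ) * (x / y)) * (1 - (s : ℂ) * (y / x))) =
      g y / (1 - (s : ℂ) * (x / y)) / (1 - y / ((s : ℂ)⁻¹ * x)) := by
    intro y
    rw [div_div]
    congr 3
    field_simp
  have hres : (s : ℂ) * (x / ((s : ℂ)⁻¹ * x)) = (s : ℂ) ^ 2 := by field_simp
  simp only [hrw]
  rw [main, hres, div_eq_inv_mul]

theorem continuousOn_laurent (c : ℤ × ℤ →₀ ℂ) :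
    ContinuousOn (fun p : ℂ × ℂ => c.sum fun k a => a * p.1 ^ k.1 * p.2 ^ k.2)
      {p | p.1 ≠ 0 ∧ p.2 ≠ 0} := by
  refine continuousOn_finsetSum _ fun k _ => ?_
  exact (continuousOn_const.mul (continuousOn_fst.zpow₀ _ fun p hp => Or.inl hp.1)).mul
    (continuousOn_snd.zpow₀ _ fun p hp => Or.inl hp.2)

theorem differentiableOn_laurent (c : ℤ × ℤ →₀ ℂ) (x : ℂ) :
    DifferentiableOn ℂ (fun y : ℂ => c.sum fun k a => a * x ^ k.1 * y ^ k.2) {0}ᶜ := by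
  unfold Finsupp.sum
  refine DifferentiableOn.fun_sum fun k _ => ?_
  exact (differentiableOn_const _).mul
    (fun y hy => ((hasDerivAt_zpow k.2 y (Or.inl hy)).differentiableAt).differentiableWithinAt)

theorem continuous_circleAvg_comp {ρ : ℝ} (hρ : 0 ≤ ρ) {F : ℂ → ℂ → ℂ}
    (hF : ContinuousOn (fun p : ℂ × ℂ => F p.1 p.2) (Metric.sphere 0 ρ ×ˢ Metric.sphere 0 ρ)) :
    Continuous fun θ : ℝ => circleAvg ρ (F ((ρ : ℂ) * Complex.exp ((θ : ℂ) * I))) := by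
  unfold circleAvg
  refine continuous_const.mul
    (intervalIntegral.continuous_parametric_intervalIntegral_of_continuous' ?_ _ _)
  refine hF.comp_continuous (f := fun p : ℝ × ℝ => ((ρ : ℂ) * Complex.exp ((p.1 : ℂ) * I),
    (ρ : ℂ) * Complex.exp ((p.2 : ℂ) * I))) (by fun_prop) fun p => ?_
  simp [Complex.norm_exp_ofReal_mul_I, abs_of_nonneg hρ]

theorem circleAvg_circleAvg_kernel_eq_add {s ξ ξ' : ℝ} (hs : 1 < s) (hξ' : 0 < ξ')
    (hlt : s * ξ' < ξ) {f : ℂ → ℂ → ℂ}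
    (hf : ∃ c : ℤ × ℤ →₀ ℂ, ∀ x y : ℂ, f x y = c.sum fun k a => a * x ^ k.1 * y ^ k.2) :
    circleAvg ξ (fun x => circleAvg ξ' fun y =>
        f x y / ((1 - (s : ℂ) * (x / y)) * (1 - (s : ℂ) * (y / x)))) =
      circleAvg ξ (fun x => circleAvg ξ fun y =>
        f x y / ((1 - (s : ℂ) * (x / y)) * (1 - (s : ℂ) * (y / x)))) +
        (1 - (s : ℂ) ^ 2)⁻¹ * circleAvg ξ (fun x => f x ((s : ℂ)⁻¹ * x)) := by
  obtain ⟨c, hc⟩ := hf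
  obtain rfl : f = fun x y => c.sum fun k a => a * x ^ k.1 * y ^ k.2 :=
    funext fun x => funext fun y => hc x y
  have hξ : 0 < ξ := by nlinarith
  have hsC : (s : ℂ) ≠ 0 := by exact_mod_cast (by linarith : s ≠ 0)
  have hsphere : ∀ z ∈ Metric.sphere (0 : ℂ) ξ, z ≠ 0 := fun z hz => by
    rw [← norm_pos_iff, mem_sphere_zero_iff_norm.1 hz]; exact hξ
  rw [← circleAvg_const_mul, ← circleAvg_add]
  · exact circleAvg_congr hξ.le fun x hx =>
      circleAvg_kernel_eq_add hs hξ' hlt (differentiableOn_laurent c x) hx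
  · refine continuous_circleAvg_comp hξ.le (F := fun x y =>
      (c.sum fun k a => a * x ^ k.1 * y ^ k.2) /
        ((1 - (s : ℂ) * (x / y)) * (1 - (s : ℂ) * (y / x)))) ?_
    refine ((continuousOn_laurent c).mono fun p hp =>
      ⟨hsphere _ hp.1, hsphere _ hp.2⟩).div ?_ ?_
    · exact (continuousOn_const.sub (continuousOn_const.mul
          (continuousOn_fst.div continuousOn_snd fun p hp => hsphere _ hp.2))).mul
        (continuousOn_const.sub (continuousOn_const.mul
          (continuousOn_snd.div continuousOn_fst fun p hp => hsphere _ hp.1)))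
    · intro p hp
      have h1 := mem_sphere_zero_iff_norm.1 hp.1
      have h2 := mem_sphere_zero_iff_norm.1 hp.2
      exact mul_ne_zero
        (one_sub_mul_div_ne_zero hs (hsphere _ hp.2) (by rw [h1, h2]; nlinarith))
        (one_sub_mul_div_ne_zero hs (hsphere _ hp.1) (by rw [h1, h2]; nlinarith))
  · refine continuous_comp_circle hξ.le (F := fun x => (1 - (s : ℂ) ^ 2)⁻¹ *
      c.sum fun k a => a * x ^ k.1 * ((s : ℂ)⁻¹ * x) ^ k.2) (continuousOn_const.mul ?_)
    exact (continuousOn_laurent c).comp (f := fun x : ℂ => (x, (s : ℂ)⁻¹ * x)) (by fun_prop)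
      fun x hx => ⟨hsphere x hx, mul_ne_zero (inv_ne_zero hsC) (hsphere x hx)⟩

theorem statement10 (q t : ℝ) (hq0 : 0 < q) (hqt : q < t) (ht1 : t < 1)
    (f : ℂ → ℂ → ℂ)
    (hf : ∃ c : ℤ × ℤ →₀ ℂ, ∀ x y : ℂ, f x y = c.sum fun k a => a * x ^ k.1 * y ^ k.2) :
    ∀ ξ ξ' : ℝ, 0 < ξ → 0 < ξ' → ξ / ξ' > (Real.sqrt q)⁻¹ * Real.sqrt t →
      I11 q t f ξ ξ' = I11 q t f ξ ξ +
        (q : ℂ) / ((q : ℂ) - (t : ℂ)) *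
          circleAvg ξ (fun x => f x ((Real.sqrt q : ℂ) * (Real.sqrt t : ℂ)⁻¹ * x)) := by
  intro ξ ξ' hξ hξ' hgt
  have ht0 : 0 < t := hq0.trans hqt
  have hsq : 0 < Real.sqrt q := Real.sqrt_pos.2 hq0
  have hst : 0 < Real.sqrt t := Real.sqrt_pos.2 ht0
  have hs : 1 < (Real.sqrt q)⁻¹ * Real.sqrt t := by
    rw [inv_mul_eq_div, one_lt_div hsq]
    exact Real.sqrt_lt_sqrt hq0.le hqt
  have main := circleAvg_circleAvg_kernel_eq_add hs hξ' ((lt_div_iff₀ hξ').1 hgt) hf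
  have hcoef : (1 - (((Real.sqrt q)⁻¹ * Real.sqrt t : ℝ) : ℂ) ^ 2)⁻¹ =
      (q : ℂ) / ((q : ℂ) - (t : ℂ)) := by
    rw [← Complex.ofReal_pow, mul_pow, inv_pow, Real.sq_sqrt hq0.le, Real.sq_sqrt ht0.le]
    norm_cast
    have h1 : q - t ≠ 0 := by linarith
    have h2 : 1 - q⁻¹ * t = (q - t) / q := by field_simp
    rw [h2, inv_div]
  rw [hcoef] at main
  simp only [Complex.ofReal_mul, Complex.ofReal_inv, mul_inv, inv_inv] at main
  exact main
end
end
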